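/- arXiv:2110.05461 — 9 statements merged into one kernel-verified Lean document; each statement's English description precedes it below -/
import Mathlib

section
/- Let F^EG(β) = -(cos β - 1)²/3 + (sin β (cos β - 4)/3) i. Then the limit as β → 0 (β real, β ≠ 0) of (F^EG(β) + iβ)/β⁴ equals -1/12; in particular the leading error of the explicit-gradient scheme relative to the exact symbol -iβ is a real (dissipative) term of third order. -/
open Filter Topology

/-- The Fourier symbol of the baseline explicit-gradient upwind scheme. -/
noncomputable def FEG (β : ℝ) : ℂ :=
  -(((Real.cos β - 1) ^ 2 / 3 : ℝ) : ℂ) +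
    ((Real.sin β * (Real.cos β - 4) / 3 : ℝ) : ℂ) * Complex.I

theorem tendsto_cos_sub_one_div_sq :
    Tendsto (fun x : ℝ => (Real.cos x - 1) / x ^ 2) (𝓝[≠] 0) (𝓝 (-1 / 2)) := by
  have hlim : Tendsto (fun x : ℝ => x ^ 2 * (5 / 96)) (𝓝[≠] 0) (𝓝 0) := by
    have h : Continuous fun x : ℝ => x ^ 2 * (5 / 96) := by fun_prop
    simpa using (h.tendsto 0).mono_left nhdsWithin_le_nhds
  refine tendsto_iff_norm_sub_tendsto_zero.2 (squeeze_zero_norm' ?_ hlim)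
  filter_upwards [self_mem_nhdsWithin,
    nhdsWithin_le_nhds (Metric.closedBall_mem_nhds (0 : ℝ) one_pos)] with x hx hx1
  have hx0 : x ≠ 0 := hx
  have hb := Real.cos_bound (x := x) (by simpa using hx1)
  have hpos : 0 < x ^ 2 := by positivity
  have heq : (Real.cos x - 1) / x ^ 2 - -1 / 2 = (Real.cos x - (1 - x ^ 2 / 2)) / x ^ 2 := by
    field_simp
    ring
  rw [norm_norm, heq, Real.norm_eq_abs, abs_div, abs_of_pos hpos, div_le_iff₀ hpos]
  calc _ ≤ |x| ^ 4 * (5 / 96) := hb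
    _ = (|x| ^ 2) ^ 2 * (5 / 96) := by ring
    _ = x ^ 2 * (5 / 96) * x ^ 2 := by rw [sq_abs]; ring

theorem abs_sin_mul_cos_sub_four_div_three_add_le {x : ℝ} (hx : |x| ≤ 1 / 2) :
    |Real.sin x * (Real.cos x - 4) / 3 + x| ≤ |x| ^ 5 / 15 := by
  have h1 := Real.sin_bound (x := x) (by linarith)
  have h2 := Real.sin_bound (x := 2 * x) (by rw [abs_mul, abs_two]; linarith)
  rw [Real.sin_two_mul, abs_mul, abs_two, mul_pow] at h2
  rw [abs_le] at h1 h2 ⊢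
  constructor <;> nlinarith [h1.1, h1.2, h2.1, h2.2]

theorem tendsto_sin_mul_cos_sub_four_div_three_add_div_pow_four :
    Tendsto (fun x : ℝ => (Real.sin x * (Real.cos x - 4) / 3 + x) / x ^ 4) (𝓝[≠] 0) (𝓝 0) := by
  have hlim : Tendsto (fun x : ℝ => |x| / 15) (𝓝[≠] 0) (𝓝 0) := by
    have h : Continuous fun x : ℝ => |x| / 15 := by fun_prop
    simpa using (h.tendsto 0).mono_left nhdsWithin_le_nhds
  refine squeeze_zero_norm' ?_ hlim
  filter_upwards [self_mem_nhdsWithin,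
    nhdsWithin_le_nhds (Metric.closedBall_mem_nhds (0 : ℝ) one_half_pos)] with x hx hx1
  have hx0 : x ≠ 0 := hx
  have hb := abs_sin_mul_cos_sub_four_div_three_add_le (x := x) (by simpa using hx1)
  rw [Real.norm_eq_abs, abs_div, abs_pow, div_le_iff₀ (by positivity)]
  calc _ ≤ |x| ^ 5 / 15 := hb
    _ = |x| / 15 * |x| ^ 4 := by ring

/-- The leading error of the explicit-gradient scheme relative to the exact
symbol -iβ is a real (dissipative) term of third order:
(F^EG(β) + iβ)/β⁴ → -1/12 as β → 0. -/
theorem explicit_gradient_leading_error :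
    Tendsto (fun β : ℝ => (FEG β + Complex.I * (β : ℂ)) / (β : ℂ) ^ 4)
      (𝓝[≠] (0 : ℝ)) (𝓝 (-1 / 12 : ℂ)) := by
  have hre := ((tendsto_cos_sub_one_div_sq.pow 2).div_const 3).neg
  have him := tendsto_sin_mul_cos_sub_four_div_three_add_div_pow_four
  have h := ((Complex.continuous_ofReal.tendsto _).comp hre).add
    (((Complex.continuous_ofReal.tendsto _).comp him).mul_const Complex.I)
  convert h using 1
  · funext β
    simp only [FEG, Function.comp_apply]
    push_cast
    ring
  · push_cast
    norm_num
end

section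
/- For every real β, the complex number h₄(β) = -sin²β (cos β + 11)²/(5 cos β + 7)² is the unique complex solution h of the Fourier-transformed second-derivative CD4 relation (5/14)(e^{-iβ} + e^{iβ}) h + h = g₄(β)[(1/28)(e^{2iβ} - e^{-2iβ}) + (11/14)(e^{iβ} - e^{-iβ})], where g₄(β) = i sin β (cos β + 11)/(5 cos β + 7); moreover h₄(β) = g₄(β)². -/
/-- The first-derivative Fourier amplitude of the CD4 compact scheme. -/
noncomputable def g4 (β : ℝ) : ℂ :=
  Complex.I * (Real.sin β : ℂ) * ((Real.cos β : ℂ) + 11) / (5 * (Real.cos β : ℂ) + 7)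

/-- The second-derivative Fourier amplitude of the CD4 compact scheme. -/
noncomputable def h4 (β : ℝ) : ℂ :=
  -((Real.sin β : ℂ) ^ 2 * ((Real.cos β : ℂ) + 11) ^ 2 / (5 * (Real.cos β : ℂ) + 7) ^ 2)

/-- h₄(β) is the unique complex solution of the Fourier-transformed
second-derivative CD4 relation, and h₄(β) = g₄(β)². -/
theorem cd4_second_derivative_amplitude (β : ℝ) :
    (∀ h : ℂ,
      (5 / 14 : ℂ) * (Complex.exp (-Complex.I * β) + Complex.exp (Complex.I * β)) * h + h =
          g4 β * ((1 / 28 : ℂ) * (Complex.exp (2 * Complex.I * β) - Complex.exp (-2 * Complex.I * β)) +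
            (11 / 14 : ℂ) * (Complex.exp (Complex.I * β) - Complex.exp (-Complex.I * β))) ↔
        h = h4 β) ∧
    h4 β = (g4 β) ^ 2 := by
  have hd : (5 * (Real.cos β : ℂ) + 7) ≠ 0 := by
    have hpos : (0 : ℝ) < 5 * Real.cos β + 7 := by linarith [Real.neg_one_le_cos β]
    exact_mod_cast hpos.ne'
  have hsq : h4 β = g4 β ^ 2 := by
    rw [h4, g4, div_pow, mul_pow, mul_pow, Complex.I_sq]
    ring
  have hp : Complex.exp (Complex.I * β) = Real.cos β + Real.sin β * Complex.I := by
    rw [mul_comm, Complex.exp_mul_I, Complex.ofReal_cos, Complex.ofReal_sin]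
  have hm : Complex.exp (-Complex.I * β) = Real.cos β - Real.sin β * Complex.I := by
    rw [show -Complex.I * (β : ℂ) = -(β : ℂ) * Complex.I by ring, Complex.exp_mul_I,
      Complex.cos_neg, Complex.sin_neg, Complex.ofReal_cos, Complex.ofReal_sin]
    ring
  have hp2 : Complex.exp (2 * Complex.I * β) = Complex.exp (Complex.I * β) ^ 2 := by
    rw [← Complex.exp_nat_mul]
    push_cast
    ring_nf
  have hm2 : Complex.exp (-2 * Complex.I * β) = Complex.exp (-Complex.I * β) ^ 2 := by
    rw [← Complex.exp_nat_mul]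
    push_cast
    ring_nf
  have hg : (5 * (Real.cos β : ℂ) + 7) * g4 β =
      Complex.I * (Real.sin β : ℂ) * ((Real.cos β : ℂ) + 11) := by
    rw [g4, mul_div_cancel₀ _ hd]
  refine ⟨fun h => ?_, hsq⟩
  rw [hp2, hm2, hp, hm, hsq]
  constructor
  · intro e
    apply mul_left_cancel₀ hd
    linear_combination 7 * e - g4 β * hg
  · rintro rfl
    linear_combination (1 / 7 : ℂ) * g4 β * hg
end

section
/- For every real β, -(1 - e^{-iβ})(1 + g₄(β)/2 + h₄(β)/12) = (cos β - 1)²(cos³β - 7cos²β + 11cos β - 5)/(12(5cos β + 7)²) - i sin β (cos⁴β - 8cos³β + 78cos²β + 728cos β + 929)/(12(5cos β + 7)²), where g₄(β) = i sin β (cos β + 11)/(5 cos β + 7) and h₄(β) = -sin²β (cos β + 11)²/(5 cos β + 7)². -/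
/-- The Fourier symbol of the IG4 scheme equals the stated closed form. -/
theorem ig4_symbol (β : ℝ) :
    -(1 - Complex.exp (-Complex.I * β)) * (1 + g4 β / 2 + h4 β / 12) =
      (((Real.cos β - 1) ^ 2 *
          ((Real.cos β) ^ 3 - 7 * (Real.cos β) ^ 2 + 11 * Real.cos β - 5) /
          (12 * (5 * Real.cos β + 7) ^ 2) : ℝ) : ℂ) -
        Complex.I *
          ((Real.sin β *
            ((Real.cos β) ^ 4 - 8 * (Real.cos β) ^ 3 + 78 * (Real.cos β) ^ 2 +
              728 * Real.cos β + 929) /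
            (12 * (5 * Real.cos β + 7) ^ 2) : ℝ) : ℂ) := by
  have hexp : Complex.exp (-Complex.I * β) =
      (Real.cos β : ℂ) - Complex.I * (Real.sin β : ℂ) := by
    rw [show -Complex.I * (β : ℂ) = ((-β : ℝ) : ℂ) * Complex.I by push_cast; ring,
      Complex.exp_mul_I, ← Complex.ofReal_cos, ← Complex.ofReal_sin, Real.cos_neg, Real.sin_neg]
    push_cast
    ring
  have hD : (Real.cos β : ℂ) * 5 + 7 ≠ 0 := by
    have h : Real.cos β * 5 + 7 ≠ 0 := ne_of_gt <| by linarith [Real.neg_one_le_cos β]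
    exact_mod_cast h
  have hsc : (Real.sin β : ℂ) ^ 2 = 1 - (Real.cos β : ℂ) ^ 2 := by
    exact_mod_cast Real.sin_sq β
  have hI : Complex.I ^ 2 = -1 := Complex.I_sq
  rw [hexp, g4, h4]
  clear hexp
  simp only [Complex.ofReal_sub, Complex.ofReal_add, Complex.ofReal_mul, Complex.ofReal_div,
    Complex.ofReal_pow, Complex.ofReal_one, Complex.ofReal_ofNat]
  generalize (Real.sin β : ℂ) = s at *
  generalize (Real.cos β : ℂ) = c at *
  generalize Complex.I = i at *
  field_simp
  grind
end

section
/- Let F^IG4(β) = (cos β - 1)²(cos³β - 7cos²β + 11cos β - 5)/(12(5cos β + 7)²) - i sin β (cos⁴β - 8cos³β + 78cos²β + 728cos β + 929)/(12(5cos β + 7)²). Then the limit as β → 0 (β real, β ≠ 0) of (F^IG4(β) + iβ)/β⁵ equals -i/720; in particular the IG4 scheme is fourth-order accurate for linear advection with a purely dispersive (imaginary) leading error. -/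
open Filter Topology

/-- The Fourier symbol of the IG4 scheme. -/
noncomputable def FIG4 (β : ℝ) : ℂ :=
  (((Real.cos β - 1) ^ 2 *
      ((Real.cos β) ^ 3 - 7 * (Real.cos β) ^ 2 + 11 * Real.cos β - 5) /
      (12 * (5 * Real.cos β + 7) ^ 2) : ℝ) : ℂ) -
    Complex.I *
      ((Real.sin β *
        ((Real.cos β) ^ 4 - 8 * (Real.cos β) ^ 3 + 78 * (Real.cos β) ^ 2 +
          728 * Real.cos β + 929) /
        (12 * (5 * Real.cos β + 7) ^ 2) : ℝ) : ℂ)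

/-- One step of L'Hôpital's rule against a power of the variable. -/
lemma tendsto_div_pow_succ {f f' : ℝ → ℝ} {n : ℕ} {l : ℝ}
    (hf : ∀ x, HasDerivAt f (f' x) x) (hf0 : f 0 = 0)
    (h : Tendsto (fun x => f' x / x ^ n) (𝓝[≠] 0) (𝓝 l)) :
    Tendsto (fun x => f x / x ^ (n + 1)) (𝓝[≠] 0) (𝓝 (l / (n + 1))) := by
  refine HasDerivAt.lhopital_zero_nhdsNE (f' := f') (g' := fun x => (n + 1) * x ^ n)
    (Eventually.of_forall hf) (Eventually.of_forall fun x => ?_) ?_ ?_ ?_ ?_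
  · simpa using hasDerivAt_pow (n + 1) x
  · filter_upwards [self_mem_nhdsWithin] with x hx
    exact mul_ne_zero (by positivity) (pow_ne_zero _ hx)
  · simpa [hf0] using ((hf 0).continuousAt.tendsto).mono_left nhdsWithin_le_nhds
  · have hc : Continuous fun x : ℝ => x ^ (n + 1) := by fun_prop
    simpa using (hc.tendsto 0).mono_left nhdsWithin_le_nhds
  · refine (h.div_const ((n : ℝ) + 1)).congr fun x => ?_
    rw [div_div, mul_comm]

lemma tendsto_sin_div : Tendsto (fun x : ℝ => Real.sin x / x) (𝓝[≠] 0) (𝓝 1) := by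
  have h : Tendsto (fun x : ℝ => Real.cos x / x ^ 0) (𝓝[≠] 0) (𝓝 1) := by
    simpa using (Real.continuous_cos.tendsto 0).mono_left nhdsWithin_le_nhds
  simpa using tendsto_div_pow_succ Real.hasDerivAt_sin Real.sin_zero h

lemma tendsto_one_sub_cos_div :
    Tendsto (fun x : ℝ => (1 - Real.cos x) / x ^ 2) (𝓝[≠] 0) (𝓝 (1 / 2)) := by
  have h : Tendsto (fun x : ℝ => Real.sin x / x ^ 1) (𝓝[≠] 0) (𝓝 1) := by
    simpa using tendsto_sin_div
  convert tendsto_div_pow_succ (f := fun x => 1 - Real.cos x) (fun x => ?_) (by simp) h using 2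
  · norm_num
  · simpa using (Real.hasDerivAt_cos x).const_sub 1

lemma tendsto_sub_sin_div :
    Tendsto (fun x : ℝ => (x - Real.sin x) / x ^ 3) (𝓝[≠] 0) (𝓝 (1 / 6)) := by
  convert tendsto_div_pow_succ (f := fun x => x - Real.sin x) (fun x => ?_) (by simp)
    tendsto_one_sub_cos_div using 2
  · norm_num
  · exact (hasDerivAt_id x).sub (Real.hasDerivAt_sin x)

lemma tendsto_cos_sub_div :
    Tendsto (fun x : ℝ => (Real.cos x - 1 + x ^ 2 / 2) / x ^ 4) (𝓝[≠] 0) (𝓝 (1 / 24)) := by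
  convert tendsto_div_pow_succ (f := fun x => Real.cos x - 1 + x ^ 2 / 2) (fun x => ?_) (by simp)
    tendsto_sub_sin_div using 2
  · norm_num
  · refine (((Real.hasDerivAt_cos x).sub_const 1).add
      ((hasDerivAt_pow 2 x).div_const 2)).congr_deriv ?_
    push_cast
    ring

lemma tendsto_sin_sub_div :
    Tendsto (fun x : ℝ => (Real.sin x - x + x ^ 3 / 6) / x ^ 5) (𝓝[≠] 0) (𝓝 (1 / 120)) := by
  convert tendsto_div_pow_succ (f := fun x => Real.sin x - x + x ^ 3 / 6) (fun x => ?_) (by simp)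
    tendsto_cos_sub_div using 2
  · norm_num
  · refine (((Real.hasDerivAt_sin x).sub (hasDerivAt_id x)).add
      ((hasDerivAt_pow 3 x).div_const 6)).congr_deriv ?_
    push_cast
    ring

lemma five_mul_cos_add_seven_ne_zero (x : ℝ) : 5 * Real.cos x + 7 ≠ 0 := by
  linarith [Real.neg_one_le_cos x]

lemma tendsto_cos_nhdsNE_zero : Tendsto Real.cos (𝓝[≠] 0) (𝓝 1) := by
  simpa using (Real.continuous_cos.tendsto 0).mono_left nhdsWithin_le_nhds

lemma tendsto_FIG4_re :
    Tendsto (fun x : ℝ => (Real.cos x - 1) ^ 2 *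
      ((Real.cos x) ^ 3 - 7 * (Real.cos x) ^ 2 + 11 * Real.cos x - 5) /
      (12 * (5 * Real.cos x + 7) ^ 2) / x ^ 5) (𝓝[≠] 0) (𝓝 0) := by
  have hx : Tendsto (fun x : ℝ => x) (𝓝[≠] 0) (𝓝 0) := tendsto_id.mono_left nhdsWithin_le_nhds
  have hc := tendsto_cos_nhdsNE_zero
  have key := (((tendsto_one_sub_cos_div.pow 4).mul (hx.pow 3)).mul (hc.sub_const 5)).div
    ((((hc.const_mul 5).add_const 7).pow 2).const_mul 12) (by norm_num)
  refine Tendsto.congr' ?_ (by convert key using 2; norm_num)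
  filter_upwards [self_mem_nhdsWithin] with x (hx0 : x ≠ 0)
  have := five_mul_cos_add_seven_ne_zero x
  simp only [Pi.div_apply]
  field_simp
  ring

lemma tendsto_FIG4_im :
    Tendsto (fun x : ℝ => (x - Real.sin x *
        ((Real.cos x) ^ 4 - 8 * (Real.cos x) ^ 3 + 78 * (Real.cos x) ^ 2 +
          728 * Real.cos x + 929) /
        (12 * (5 * Real.cos x + 7) ^ 2)) / x ^ 5) (𝓝[≠] 0) (𝓝 (-1 / 720)) := by
  have hx : Tendsto (fun x : ℝ => x) (𝓝[≠] 0) (𝓝 0) := tendsto_id.mono_left nhdsWithin_le_nhds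
  have ht := tendsto_sin_div
  have hv := tendsto_one_sub_cos_div
  have ha := tendsto_sin_sub_div
  have hb := tendsto_cos_sub_div
  have hD := (((tendsto_cos_nhdsNE_zero.const_mul 5).add_const 7).pow 2).const_mul 12
  have hx2 := hx.pow 2
  have key := (((((hD.mul ha).neg.add
    ((hb.add (((ha.mul hx2).const_sub (1 / 6)).mul hv)).const_mul 576)).sub
    (hv.const_mul 240)).add (((hv.pow 2).mul hx2).const_mul 50)).add
    ((ht.mul (hv.pow 2)).const_mul 240)).sub
    ((((hv.mul hx2).const_add 4).mul ht).mul ((hv.pow 3).mul hx2)) |>.div hD (by norm_num)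
  refine Tendsto.congr' ?_ (by convert key using 2; norm_num)
  filter_upwards [self_mem_nhdsWithin] with x (hx0 : x ≠ 0)
  have := five_mul_cos_add_seven_ne_zero x
  simp only [Pi.div_apply]
  field_simp
  ring

/-- The IG4 scheme is fourth-order accurate for linear advection with a purely
dispersive (imaginary) leading error: (F^IG4(β) + iβ)/β⁵ → -i/720. -/
theorem ig4_fourth_order :
    Tendsto (fun β : ℝ => (FIG4 β + Complex.I * (β : ℂ)) / (β : ℂ) ^ 5)
      (𝓝[≠] (0 : ℝ)) (𝓝 (-Complex.I / 720)) := by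
  have key := ((Complex.continuous_ofReal.tendsto _).comp tendsto_FIG4_re).add
    (((Complex.continuous_ofReal.tendsto _).comp tendsto_FIG4_im).const_mul Complex.I)
  have hl : ((0 : ℝ) : ℂ) + Complex.I * ((-1 / 720 : ℝ) : ℂ) = -Complex.I / 720 := by
    push_cast
    ring
  rw [hl] at key
  refine key.congr fun x => ?_
  simp only [FIG4, Function.comp_apply, Complex.ofReal_div, Complex.ofReal_sub,
    Complex.ofReal_pow]
  ring
end

section
/- Let F^IG4(β) = (cos β - 1)²(cos³β - 7cos²β + 11cos β - 5)/(12(5cos β + 7)²) - i sin β (cos⁴β - 8cos³β + 78cos²β + 728cos β + 929)/(12(5cos β + 7)²). Then for every real β, Re F^IG4(β) = (cos β - 1)⁴(cos β - 5)/(12(5cos β + 7)²), and the limit as β → 0 (β real, β ≠ 0) of Re F^IG4(β)/β⁸ equals -1/6912; in particular the dissipative error of IG4 vanishes to very high order (there are no third- or fifth-order dissipative error terms). -/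
open Filter Topology

theorem cos_sub_one_eq_sinc (β : ℝ) :
    Real.cos β - 1 = -(1 / 2) * β ^ 2 * Real.sinc (β / 2) ^ 2 := by
  rcases eq_or_ne β 0 with rfl | hβ
  · simp
  · have h : Real.cos β = 1 - 2 * Real.sin (β / 2) ^ 2 := by
      rw [Real.sin_sq_eq_half_sub, mul_div_cancel₀ β two_ne_zero]
      ring
    rw [Real.sinc_of_ne_zero (div_ne_zero hβ two_ne_zero), h]
    field_simp
    ring

theorem FIG4_re (β : ℝ) :
    (FIG4 β).re =
      (Real.cos β - 1) ^ 4 * (Real.cos β - 5) / (12 * (5 * Real.cos β + 7) ^ 2) := by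
  rw [FIG4, Complex.sub_re, Complex.ofReal_re, Complex.re_mul_ofReal, Complex.I_re, zero_mul,
    sub_zero]
  ring

/-- The dissipative (real) part of the IG4 symbol factors as
(cos β - 1)⁴(cos β - 5)/(12(5cos β + 7)²) and vanishes to eighth order:
Re F^IG4(β)/β⁸ → -1/6912 as β → 0. -/
theorem ig4_dissipative_error :
    (∀ β : ℝ, (FIG4 β).re =
      (Real.cos β - 1) ^ 4 * (Real.cos β - 5) / (12 * (5 * Real.cos β + 7) ^ 2)) ∧
    Tendsto (fun β : ℝ => (FIG4 β).re / β ^ 8)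
      (𝓝[≠] (0 : ℝ)) (𝓝 (-1 / 6912 : ℝ)) := by
  refine ⟨FIG4_re, ?_⟩
  have hcont : ContinuousAt (fun β : ℝ => Real.sinc (β / 2) ^ 8 / 16 * (Real.cos β - 5) /
      (12 * (5 * Real.cos β + 7) ^ 2)) 0 := by
    refine ContinuousAt.div ?_ (by fun_prop) (by norm_num)
    have := Real.continuous_sinc
    fun_prop
  have hval : Real.sinc (0 / 2) ^ 8 / 16 * (Real.cos 0 - 5) /
      (12 * (5 * Real.cos 0 + 7) ^ 2) = -1 / 6912 := by
    norm_num
  rw [← hval]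
  refine (hcont.tendsto.mono_left nhdsWithin_le_nhds).congr' ?_
  filter_upwards [self_mem_nhdsWithin] with β hβ
  have hβ : β ≠ 0 := hβ
  rw [FIG4_re, cos_sub_one_eq_sinc]
  field_simp
  ring
end

section
/- For every real β, the complex number h₆(β) = -sin²β (cos β + 14)²/(9(2 cos β + 3)²) is the unique complex solution h of the Fourier-transformed second-derivative CD6 relation (1/3)(e^{-iβ} + e^{iβ}) h + h = g₆(β)[(1/36)(e^{2iβ} - e^{-2iβ}) + (7/9)(e^{iβ} - e^{-iβ})], where g₆(β) = i sin β (cos β + 14)/(3(2 cos β + 3)); moreover h₆(β) = g₆(β)². -/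
/-- The first-derivative Fourier amplitude of the CD6 compact scheme. -/
noncomputable def g6 (β : ℝ) : ℂ :=
  Complex.I * (Real.sin β : ℂ) * ((Real.cos β : ℂ) + 14) / (3 * (2 * (Real.cos β : ℂ) + 3))

/-- The second-derivative Fourier amplitude of the CD6 compact scheme. -/
noncomputable def h6 (β : ℝ) : ℂ :=
  -((Real.sin β : ℂ) ^ 2 * ((Real.cos β : ℂ) + 14) ^ 2 / (9 * (2 * (Real.cos β : ℂ) + 3) ^ 2))

theorem two_mul_cos_add_three_ne_zero (β : ℝ) : 2 * (Real.cos β : ℂ) + 3 ≠ 0 := by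
  have h : 2 * Real.cos β + 3 ≠ 0 := by linarith [Real.neg_one_le_cos β]
  exact_mod_cast h

theorem exp_I_mul_ofReal (β : ℝ) :
    Complex.exp (Complex.I * β) = Real.cos β + Real.sin β * Complex.I := by
  rw [mul_comm, Complex.exp_mul_I, Complex.ofReal_cos, Complex.ofReal_sin]

theorem exp_neg_I_mul_ofReal (β : ℝ) :
    Complex.exp (-Complex.I * β) = Real.cos β - Real.sin β * Complex.I := by
  simpa [sub_eq_add_neg] using exp_I_mul_ofReal (-β)

/-- The symbol of the left-hand side of the CD6 relation. -/
theorem cd6_lhs_symbol (β : ℝ) :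
    (1 / 3 : ℂ) * (Complex.exp (-Complex.I * β) + Complex.exp (Complex.I * β)) =
      2 / 3 * Real.cos β := by
  rw [exp_I_mul_ofReal, exp_neg_I_mul_ofReal]
  ring

/-- The symbol of the right-hand side of the CD6 relation. -/
theorem cd6_rhs_symbol (β : ℝ) :
    (1 / 36 : ℂ) * (Complex.exp (2 * Complex.I * β) - Complex.exp (-2 * Complex.I * β)) +
        (7 / 9 : ℂ) * (Complex.exp (Complex.I * β) - Complex.exp (-Complex.I * β)) =
      (2 * Real.cos β + 3) / 3 * g6 β := by
  have h₁ : Complex.exp (2 * Complex.I * β) = Complex.exp (Complex.I * β) ^ 2 := by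
    rw [← Complex.exp_nat_mul]
    push_cast
    ring_nf
  have h₂ : Complex.exp (-2 * Complex.I * β) = Complex.exp (-Complex.I * β) ^ 2 := by
    rw [← Complex.exp_nat_mul]
    push_cast
    ring_nf
  have h := two_mul_cos_add_three_ne_zero β
  rw [h₁, h₂, exp_I_mul_ofReal, exp_neg_I_mul_ofReal, g6, div_mul_div_comm,
    eq_div_iff (mul_ne_zero three_ne_zero (mul_ne_zero three_ne_zero h))]
  ring

theorem h6_eq_g6_sq (β : ℝ) : h6 β = g6 β ^ 2 := by
  rw [h6, g6, div_pow, mul_pow, mul_pow, Complex.I_sq]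
  ring

/-- h₆(β) is the unique complex solution of the Fourier-transformed
second-derivative CD6 relation, and h₆(β) = g₆(β)². -/
theorem cd6_second_derivative_amplitude (β : ℝ) :
    (∀ h : ℂ,
      (1 / 3 : ℂ) * (Complex.exp (-Complex.I * β) + Complex.exp (Complex.I * β)) * h + h =
          g6 β * ((1 / 36 : ℂ) * (Complex.exp (2 * Complex.I * β) - Complex.exp (-2 * Complex.I * β)) +
            (7 / 9 : ℂ) * (Complex.exp (Complex.I * β) - Complex.exp (-Complex.I * β))) ↔
        h = h6 β) ∧
    h6 β = (g6 β) ^ 2 := by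
  refine ⟨fun h => ?_, h6_eq_g6_sq β⟩
  have hd : (2 * (Real.cos β : ℂ) + 3) / 3 ≠ 0 :=
    div_ne_zero (two_mul_cos_add_three_ne_zero β) three_ne_zero
  rw [cd6_lhs_symbol, cd6_rhs_symbol, h6_eq_g6_sq, ← mul_right_inj' hd (b := h)]
  constructor <;> intro e <;> linear_combination e
end

section
/- For every real β, -(1 - e^{-iβ})(1 + g₆(β)/2 + h₆(β)/12) = (cos β - 1)²(cos³β - 7cos²β + 26cos β - 20)/(108(2cos β + 3)²) - i sin β (cos⁴β - 8cos³β + 105cos²β + 1070cos β + 1532)/(108(2cos β + 3)²), where g₆(β) = i sin β (cos β + 14)/(3(2 cos β + 3)) and h₆(β) = -sin²β (cos β + 14)²/(9(2 cos β + 3)²). -/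
/-- The Fourier symbol of the IG6 scheme equals the stated closed form. -/
theorem ig6_symbol (β : ℝ) :
    -(1 - Complex.exp (-Complex.I * β)) * (1 + g6 β / 2 + h6 β / 12) =
      (((Real.cos β - 1) ^ 2 *
          ((Real.cos β) ^ 3 - 7 * (Real.cos β) ^ 2 + 26 * Real.cos β - 20) /
          (108 * (2 * Real.cos β + 3) ^ 2) : ℝ) : ℂ) -
        Complex.I *
          ((Real.sin β *
            ((Real.cos β) ^ 4 - 8 * (Real.cos β) ^ 3 + 105 * (Real.cos β) ^ 2 +
              1070 * Real.cos β + 1532) /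
            (108 * (2 * Real.cos β + 3) ^ 2) : ℝ) : ℂ) := by
  have hexp : Complex.exp (-Complex.I * β) = Complex.cos β - Complex.sin β * Complex.I := by
    rw [neg_mul, mul_comm, ← neg_mul, Complex.exp_mul_I, Complex.cos_neg, Complex.sin_neg]
    ring
  have hden : (2 * Complex.cos β + 3 : ℂ) ≠ 0 := by
    have h : (2 * Real.cos β + 3 : ℝ) ≠ 0 := ne_of_gt (by linarith [Real.neg_one_le_cos β])
    exact_mod_cast h
  have hsq := Complex.sin_sq_add_cos_sq (β : ℂ)
  have hI := Complex.I_sq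
  rw [hexp, g6, h6]
  push_cast
  generalize Complex.cos (β : ℂ) = c at *
  generalize Complex.sin (β : ℂ) = s at *
  have hlhs : -(1 - (c - s * Complex.I)) *
      (1 + Complex.I * s * (c + 14) / (3 * (2 * c + 3)) / 2 +
        -(s ^ 2 * (c + 14) ^ 2 / (9 * (2 * c + 3) ^ 2)) / 12) =
      -(1 - (c - s * Complex.I)) *
        (108 * (2 * c + 3) ^ 2 + 18 * Complex.I * s * (c + 14) * (2 * c + 3) -
          s ^ 2 * (c + 14) ^ 2) / (108 * (2 * c + 3) ^ 2) := by
    generalize 2 * c + 3 = d at hden ⊢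
    field_simp
    ring
  rw [hlhs, ← mul_div_assoc, ← sub_div]
  congr 1
  linear_combination (-18 * s ^ 2 * (c + 14) * (2 * c + 3)) * hI +
    ((1 - c) * (c + 14) ^ 2 + 18 * (c + 14) * (2 * c + 3) +
      Complex.I * s * (c + 14) ^ 2) * hsq
end

section
/- Let f : ℝ → ℝ be five times continuously differentiable and let x ∈ ℝ. Define, for h ≠ 0, E₄(h) = (5/14)f'(x-h) + f'(x) + (5/14)f'(x+h) - (1/(28h))(f(x+2h) - f(x-2h)) - (11/(14h))(f(x+h) - f(x-h)). Then the limit as h → 0 (h ≠ 0) of E₄(h)/h⁴ equals -(1/420) f⁽⁵⁾(x); in particular the CD4 compact scheme approximates the first derivative to fourth order. -/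
open Filter Topology

/-- Taylor's theorem with Peano remainder along the ray `h ↦ x + c * h`. -/
lemma tendsto_taylor_remainder_div_pow {f : ℝ → ℝ} {n : ℕ} (hf : ContDiff ℝ n f) (x c : ℝ) :
    Tendsto
      (fun h : ℝ =>
        (f (x + c * h) -
          ∑ k ∈ Finset.range (n + 1), iteratedDeriv k f x * (c * h) ^ k / (k.factorial : ℝ)) / h ^ n)
      (𝓝[≠] (0 : ℝ)) (𝓝 0) := by
  have hray : Tendsto (fun h : ℝ => x + c * h) (𝓝[≠] 0) (𝓝 x) := by
    have : Tendsto (fun h : ℝ => x + c * h) (𝓝 0) (𝓝 (x + c * 0)) :=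
      Continuous.tendsto (by fun_prop) 0
    simpa using this.mono_left nhdsWithin_le_nhds
  have hlittle := (taylor_isLittleO_univ (x₀ := x) hf).comp_tendsto hray
  have hbig : (fun h : ℝ => (c * h) ^ n) =O[𝓝[≠] 0] fun h : ℝ => h ^ n := by
    simp only [mul_pow]
    exact (Asymptotics.isBigO_refl _ _).const_mul_left _
  refine ((hlittle.congr_right (g₂ := fun h => (c * h) ^ n) ?_).trans_isBigO
    hbig).tendsto_div_nhds_zero.congr ?_
  · intro h
    simp
  · intro h
    simp only [Function.comp_apply, taylor_within_apply, iteratedDerivWithin_univ, smul_eq_mul,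
      add_sub_cancel_left]
    congr 2
    refine Finset.sum_congr rfl fun k _ => ?_
    ring

/-- The CD4 compact scheme approximates the first derivative to fourth order:
its truncation error satisfies E₄(h)/h⁴ → -(1/420) f⁽⁵⁾(x) as h → 0. -/
theorem cd4_truncation_error (f : ℝ → ℝ) (hf : ContDiff ℝ 5 f) (x : ℝ) :
    Tendsto
      (fun h : ℝ =>
        ((5 / 14) * deriv f (x - h) + deriv f x + (5 / 14) * deriv f (x + h) -
            (1 / (28 * h)) * (f (x + 2 * h) - f (x - 2 * h)) -
            (11 / (14 * h)) * (f (x + h) - f (x - h))) / h ^ 4)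
      (𝓝[≠] (0 : ℝ)) (𝓝 (-(1 / 420) * iteratedDeriv 5 f x)) := by
  have hf' : ContDiff ℝ (4 : ℕ) (deriv f) :=
    ((contDiff_succ_iff_deriv (n := 4)).1 (show ContDiff ℝ (4 + 1) f from hf)).2.2
  have hT := tendsto_taylor_remainder_div_pow (n := 5) (by exact_mod_cast hf) x
  have hT' := tendsto_taylor_remainder_div_pow hf' x
  have key := ((((hT' (-1)).add (hT' 1)).const_mul (5 / 14)).sub
    (((hT 2).sub (hT (-2))).const_mul (1 / 28))).sub
    (((hT 1).sub (hT (-1))).const_mul (11 / 14)) |>.add_const (-(1 / 420) * iteratedDeriv 5 f x)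
  simp only [add_zero, sub_zero, mul_zero, zero_add] at key
  refine key.congr' ?_
  filter_upwards [self_mem_nhdsWithin] with h hh
  have hh : h ≠ 0 := hh
  have hneg : x + -1 * h = x - h := by ring
  have hneg2 : x + -2 * h = x - 2 * h := by ring
  simp only [Finset.sum_range_succ, Finset.sum_range_zero, ← iteratedDeriv_succ', hneg, hneg2,
    one_mul, Nat.factorial, iteratedDeriv_zero, zero_add, Nat.reduceAdd, iteratedDeriv_one]
  push_cast
  field_simp
  ring
end

section
/- Let f : ℝ → ℝ be seven times continuously differentiable and let x ∈ ℝ. Define, for h ≠ 0, E₆(h) = (1/3)f'(x-h) + f'(x) + (1/3)f'(x+h) - (1/(36h))(f(x+2h) - f(x-2h)) - (7/(9h))(f(x+h) - f(x-h)). Then the limit as h → 0 (h ≠ 0) of E₆(h)/h⁶ equals -(1/1260) f⁽⁷⁾(x); in particular the CD6 compact scheme approximates the first derivative to sixth order. -/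
open Filter Topology

/-- Taylor's theorem with Peano remainder, along the scaled increments `c * h`. -/
lemma tendsto_taylor_remainder_scaled {g : ℝ → ℝ} {n : ℕ} (hg : ContDiff ℝ n g) (x c : ℝ) :
    Tendsto
      (fun h : ℝ => (g (x + c * h) -
        ∑ k ∈ Finset.range (n + 1), (c * h) ^ k / (k.factorial : ℝ) * iteratedDeriv k g x) / h ^ n)
      (𝓝[≠] 0) (𝓝 0) := by
  have hlim : Tendsto (fun h : ℝ => x + c * h) (𝓝 0) (𝓝 x) := by
    have : Continuous fun h : ℝ => x + c * h := by fun_prop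
    simpa using this.tendsto 0
  have hO : (fun h : ℝ => (x + c * h - x) ^ n) =O[𝓝 0] fun h => h ^ n := by
    simp only [add_sub_cancel_left, mul_pow]
    exact Asymptotics.isBigO_const_mul_self _ _ _
  have key := (((taylor_isLittleO_univ (x₀ := x) hg).comp_tendsto hlim).trans_isBigO hO).mono
    (nhdsWithin_le_nhds (s := {0}ᶜ))
  refine key.tendsto_div_nhds_zero.congr fun h => ?_
  simp only [Function.comp_apply, taylor_within_apply, iteratedDerivWithin_univ, smul_eq_mul,
    add_sub_cancel_left]
  congr 2
  exact Finset.sum_congr rfl fun k _ => by ring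

/-- The CD6 compact scheme approximates the first derivative to sixth order:
its truncation error satisfies E₆(h)/h⁶ → -(1/1260) f⁽⁷⁾(x) as h → 0. -/
theorem cd6_truncation_error (f : ℝ → ℝ) (hf : ContDiff ℝ 7 f) (x : ℝ) :
    Tendsto
      (fun h : ℝ =>
        ((1 / 3) * deriv f (x - h) + deriv f x + (1 / 3) * deriv f (x + h) -
            (1 / (36 * h)) * (f (x + 2 * h) - f (x - 2 * h)) -
            (7 / (9 * h)) * (f (x + h) - f (x - h))) / h ^ 6)
      (𝓝[≠] (0 : ℝ)) (𝓝 (-(1 / 1260) * iteratedDeriv 7 f x)) := by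
  have hf' : ContDiff ℝ (6 : ℕ) (deriv f) :=
    ContDiff.deriv' (n := 6) (by exact_mod_cast hf)
  have R := tendsto_taylor_remainder_scaled (n := 7) (by exact_mod_cast hf) x
  have r := tendsto_taylor_remainder_scaled hf' x
  have key := (((((r 1).add (r (-1))).const_mul (1 / 3)).sub
    (((R 2).sub (R (-2))).const_mul (1 / 36))).sub
    (((R 1).sub (R (-1))).const_mul (7 / 9))).const_add (-(1 / 1260) * iteratedDeriv 7 f x)
  simp only [add_zero, sub_zero, mul_zero] at key
  refine key.congr' ?_
  filter_upwards [self_mem_nhdsWithin] with h hh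
  have hh : h ≠ 0 := hh
  simp only [Finset.sum_range_succ, Finset.sum_range_zero, ← iteratedDeriv_succ',
    Nat.factorial, one_mul, neg_mul, ← sub_eq_add_neg, iteratedDeriv_zero, iteratedDeriv_one,
    zero_add, Nat.reduceAdd]
  push_cast
  field_simp
  ring
end
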